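/- arXiv:1305.1831 — 3 statements merged into one kernel-verified Lean document; each statement's English description precedes it below -/
import Mathlib

section
/- Let q = 3^m with m odd and m not divisible by 3, and let u be a nonzero element of GF(q). Then D_u ∩ (−D_u) = ∅ and D_u ∪ (−D_u) ∪ {0} = GF(q), where −D_u = {−d : d ∈ D_u}. -/
/-- The Dickson polynomial of the first kind of order `7` in characteristic `3`. -/
def dickson7 {R : Type*} [CommRing R] (u x : R) : R :=
  x ^ 7 - u * x ^ 5 - u ^ 2 * x ^ 3 - u ^ 3 * x

theorem dickson7_neg {R : Type*} [CommRing R] (u x : R) : dickson7 u (-x) = -dickson7 u x := by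
  unfold dickson7
  ring

theorem dickson7_zero {R : Type*} [CommRing R] (u : R) : dickson7 u 0 = 0 := by
  simp [dickson7]

theorem dickson7_add {R : Type*} [CommRing R] [CharP R 3] (a b : R) :
    dickson7 (a * b) (a + b) = a ^ 7 + b ^ 7 := by
  have h3 : (3 : R) = 0 := by exact_mod_cast CharP.cast_eq_zero R 3
  have key : dickson7 (a * b) (a + b) - (a ^ 7 + b ^ 7) =
      3 * (2 * (a * b) * (a + b) ^ 5 - 5 * (a * b) ^ 2 * (a + b) ^ 3
        + 2 * (a * b) ^ 3 * (a + b)) := by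
    unfold dickson7
    ring
  rw [h3, zero_mul] at key
  exact sub_eq_zero.mp key

theorem eq_or_eq_of_add_eq_add_of_mul_eq_mul {R : Type*} [CommRing R] [IsDomain R]
    {a b c d : R} (hadd : a + b = c + d) (hmul : a * b = c * d) : a = c ∨ a = d := by
  have h : (a - c) * (a - d) = 0 := by linear_combination a * hadd - hmul
  rcases mul_eq_zero.mp h with h | h
  · exact Or.inl (sub_eq_zero.mp h)
  · exact Or.inr (sub_eq_zero.mp h)

theorem exists_add_mul_eq {K : Type*} [Field K] [IsAlgClosed K] (x u : K) :
    ∃ a b : K, a + b = x ∧ a * b = u := by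
  obtain ⟨a, ha⟩ := IsAlgClosed.exists_root
    (Polynomial.X ^ 2 - Polynomial.C x * Polynomial.X + Polynomial.C u : Polynomial K) (by
      have : (Polynomial.X ^ 2 - Polynomial.C x * Polynomial.X + Polynomial.C u :
          Polynomial K).degree = 2 := by compute_degree!
      simp [this])
  refine ⟨a, x - a, by ring, ?_⟩
  simp only [Polynomial.IsRoot, Polynomial.eval_add, Polynomial.eval_sub, Polynomial.eval_pow,
    Polynomial.eval_mul, Polynomial.eval_X, Polynomial.eval_C] at ha
  linear_combination -ha

/-- A root of a quadratic whose coefficients are fixed by the `p ^ m`-power map is fixed by its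
square. -/
theorem pow_pow_eq_of_add_mul {K : Type*} [Field K] (p : ℕ) [ExpChar K p] (m : ℕ) {a b : K}
    (hadd : (a + b) ^ p ^ m = a + b) (hmul : (a * b) ^ p ^ m = a * b) :
    (a ^ p ^ m) ^ p ^ m = a := by
  have hadd' := hadd
  rw [add_pow_expChar_pow] at hadd
  have hmul' := hmul
  rw [mul_pow] at hmul'
  rcases eq_or_eq_of_add_eq_add_of_mul_eq_mul hadd hmul' with h | h
  · rw [h, h]
  · rw [h] at hadd ⊢
    linear_combination hadd

theorem coprime_seven_three_pow {m : ℕ} (hm3 : ¬ 3 ∣ m) :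
    Nat.Coprime 7 (3 ^ m * 3 ^ m - 1) := by
  rw [Nat.Prime.coprime_iff_not_dvd (by norm_num), ← Nat.modEq_iff_dvd'
    (Nat.one_le_iff_ne_zero.mpr (by positivity)), ← mul_pow]
  intro h
  apply hm3
  have hm := Nat.div_add_mod m 3
  generalize m / 3 = k at hm
  have hk : ((3 * 3) ^ 3) ^ k ≡ 1 [MOD 7] := by
    simpa using (show (3 * 3) ^ 3 ≡ 1 [MOD 7] by decide).pow k
  rw [← hm, pow_add, pow_mul] at h
  have h2 := h.trans (hk.mul_right _)
  have h3 : m % 3 < 3 := Nat.mod_lt _ (by norm_num)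
  apply Nat.dvd_of_mod_eq_zero
  rw [one_mul] at h2
  generalize m % 3 = r at h2 h3
  interval_cases r
  · rfl
  · exact absurd h2 (by decide)
  · exact absurd h2 (by decide)

theorem eq_of_pow_eq_pow_of_coprime {K : Type*} [Field K] {a b : K} {n Q : ℕ} (hQ : 1 ≤ Q)
    (hn : n.Coprime (Q - 1)) (hb : b ≠ 0) (ha' : a ^ Q = a) (hb' : b ^ Q = b) (ha : a ≠ 0)
    (h : a ^ n = b ^ n) : a = b := by
  have hfix : ∀ c : K, c ≠ 0 → c ^ Q = c → c ^ (Q - 1) = 1 := fun c hc hcQ => by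
    apply mul_right_cancel₀ hc
    rw [← pow_succ, Nat.sub_add_cancel hQ, hcQ, one_mul]
  have h1 : (a / b) ^ n = 1 := by rw [div_pow, h, div_self (pow_ne_zero _ hb)]
  have h2 : (a / b) ^ (Q - 1) = 1 := by rw [div_pow, hfix a ha ha', hfix b hb hb', div_one]
  have h3 : a / b = 1 := by
    have h := pow_gcd_eq_one.mpr ⟨h1, h2⟩
    rwa [hn.gcd_eq_one, pow_one] at h
  exact (div_eq_one_iff_eq hb).mp h3

theorem dickson7_injective {m : ℕ} (hm3 : ¬ 3 ∣ m) {F : Type*} [Field F] [Fintype F]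
    [CharP F 3] (hcard : Fintype.card F = 3 ^ m) {u : F} (hu : u ≠ 0) :
    Function.Injective (dickson7 u) := by
  intro x y hxy
  let K := AlgebraicClosure F
  have : CharP K 3 := charP_of_injective_algebraMap (algebraMap F K).injective 3
  have : Fact (Nat.Prime 3) := ⟨Nat.prime_three⟩
  have hfix : ∀ z : F, (algebraMap F K z) ^ 3 ^ m = algebraMap F K z := fun z => by
    rw [← map_pow, ← hcard, FiniteField.pow_card]
  have hu' : algebraMap F K u ≠ 0 := by simpa using hu
  have hmap : ∀ z : F, algebraMap F K (dickson7 u z) =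
      dickson7 (algebraMap F K u) (algebraMap F K z) := fun z => by simp [dickson7]
  obtain ⟨a, b, hab, hab'⟩ := exists_add_mul_eq (algebraMap F K x) (algebraMap F K u)
  obtain ⟨c, d, hcd, hcd'⟩ := exists_add_mul_eq (algebraMap F K y) (algebraMap F K u)
  have ha : a ≠ 0 := by rintro rfl; simp [← hab'] at hu'
  have hc : c ≠ 0 := by rintro rfl; simp [← hcd'] at hu'
  have hd : d ≠ 0 := by rintro rfl; simp [← hcd'] at hu'
  have hdick : a ^ 7 + b ^ 7 = c ^ 7 + d ^ 7 := by
    rw [← dickson7_add, ← dickson7_add, hab, hab', hcd, hcd', ← hmap, ← hmap, hxy]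
  have hmul : a ^ 7 * b ^ 7 = c ^ 7 * d ^ 7 := by
    rw [← mul_pow, ← mul_pow, hab', hcd']
  have hQ : ∀ s t : K, ∀ z : F, s + t = algebraMap F K z → s * t = algebraMap F K u →
      s ^ (3 ^ m * 3 ^ m) = s := fun s t z hst hst' => by
    rw [pow_mul]
    exact pow_pow_eq_of_add_mul 3 m (b := t) (by rw [hst, hfix]) (by rw [hst', hfix])
  have hQ1 : 1 ≤ 3 ^ m * 3 ^ m := Nat.one_le_iff_ne_zero.mpr (by positivity)
  have hroot : a = c ∨ a = d :=
    (eq_or_eq_of_add_eq_add_of_mul_eq_mul hdick hmul).imp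
      (eq_of_pow_eq_pow_of_coprime hQ1 (coprime_seven_three_pow hm3) hc
        (hQ a b x hab hab') (hQ c d y hcd hcd') ha)
      (eq_of_pow_eq_pow_of_coprime hQ1 (coprime_seven_three_pow hm3) hd
        (hQ a b x hab hab') (hQ d c y (by rw [add_comm, hcd]) (by rw [mul_comm, hcd'])) ha)
  apply (algebraMap F K).injective
  rw [← hab, ← hcd]
  rcases hroot with rfl | rfl
  · rw [mul_left_cancel₀ ha (hab'.trans hcd'.symm)]
  · rw [mul_left_cancel₀ ha ((hab'.trans hcd'.symm).trans (mul_comm c a)), add_comm]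

theorem FiniteField.isSquare_or_isSquare_neg {F : Type*} [Field F] [Fintype F]
    (h : ¬ IsSquare (-1 : F)) (t : F) : IsSquare t ∨ IsSquare (-t) := by
  classical
  have hF : ringChar F ≠ 2 := fun h2 => h (FiniteField.isSquare_of_char_two h2 _)
  rcases eq_or_ne t 0 with rfl | ht
  · exact Or.inl IsSquare.zero
  rcases FiniteField.pow_dichotomy hF ht with h1 | h1
  · exact Or.inl ((FiniteField.isSquare_iff hF ht).mpr h1)
  · right
    rw [FiniteField.isSquare_iff hF (neg_ne_zero.mpr ht), ← neg_one_mul, mul_pow, h1]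
    have hne : (-1 : F) ≠ 0 := neg_ne_zero.mpr one_ne_zero
    rw [FiniteField.isSquare_iff hF hne] at h
    rw [(FiniteField.pow_dichotomy hF hne).resolve_left h]
    ring

/-- For `q = 3^m` with `m` odd and `3 ∤ m`, and `u ≠ 0` in `GF(q)`, the image set
`D_u = {D_7(x², u) : x ≠ 0}` satisfies `D_u ∩ (-D_u) = ∅` and
`D_u ∪ (-D_u) ∪ {0} = GF(q)`. -/
theorem dickson7_image_skew
    (m : ℕ) (hm : Odd m) (hm3 : ¬ (3 ∣ m)) (F : Type*) [Field F] [Fintype F]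
    (hcard : Fintype.card F = 3 ^ m) (u : F) (hu : u ≠ 0) :
    let Du : Set F := {y | ∃ x : F, x ≠ 0 ∧
      y = (x ^ 2) ^ 7 - u * (x ^ 2) ^ 5 - u ^ 2 * (x ^ 2) ^ 3 - u ^ 3 * x ^ 2}
    Du ∩ ((fun d => -d) '' Du) = ∅ ∧ Du ∪ ((fun d => -d) '' Du) ∪ {0} = Set.univ := by
  intro Du
  have : CharP F 3 := by
    have : Fact (Nat.Prime 3) := ⟨Nat.prime_three⟩
    exact charP_of_card_eq_prime_pow hcard
  have hneg : ¬ IsSquare (-1 : F) := by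
    rw [FiniteField.isSquare_neg_one_iff, hcard, not_not]
    obtain ⟨k, rfl⟩ := hm
    rw [pow_succ, pow_mul, Nat.mul_mod, Nat.pow_mod]
    norm_num
  have hinj := dickson7_injective hm3 hcard hu
  have hDu : ∀ y, y ∈ Du ↔ ∃ x : F, x ≠ 0 ∧ y = dickson7 u (x ^ 2) := fun y => Iff.rfl
  constructor
  · rw [Set.eq_empty_iff_forall_notMem]
    rintro _ ⟨⟨x, hx, rfl⟩, _, ⟨z, hz, rfl⟩, h⟩
    have h' : -dickson7 u (z ^ 2) = dickson7 u (x ^ 2) := h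
    rw [← dickson7_neg] at h'
    have hsq : -(z ^ 2) = x ^ 2 := hinj h'
    refine hneg ⟨x / z, ?_⟩
    field_simp
    linear_combination hsq
  · rw [Set.eq_univ_iff_forall]
    intro y
    obtain ⟨t, rfl⟩ := Finite.surjective_of_injective hinj y
    rcases eq_or_ne t 0 with rfl | ht
    · exact Or.inr (dickson7_zero u)
    left
    rcases FiniteField.isSquare_or_isSquare_neg hneg t with ⟨r, hr⟩ | ⟨r, hr⟩
    · refine Or.inl ((hDu _).mpr ⟨r, ?_, by rw [hr, sq]⟩)
      rintro rfl
      simp [hr] at ht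
    · refine Or.inr ⟨dickson7 u (-t), (hDu _).mpr ⟨r, ?_, by rw [hr, sq]⟩, ?_⟩
      · rintro rfl
        simp_all
      · simp [dickson7_neg]
end

section
/- Let q = 3^m with m odd and m not divisible by 3. For every integer a with 0 ≤ a ≤ q − 2, we have w(r) + w(s) ≥ m, where r is the unique integer with 0 ≤ r ≤ q − 2 and r ≡ 5a (mod q − 1), and s is the unique integer with 0 ≤ s ≤ q − 2 and s ≡ (q−1)/2 − 7a (mod q − 1). -/
theorem sum_digits_three_eq (n : ℕ) :
    (Nat.digits 3 n).sum = n % 3 + (Nat.digits 3 (n / 3)).sum := by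
  rcases Nat.eq_zero_or_pos n with rfl | hn
  · simp
  · rw [Nat.digits_def' (by norm_num) hn, List.sum_cons]

/-- A potential on the carries of the addition `7 * r + 5 * s` in base `3`. -/
def carryPotential (c : ℕ) : ℕ :=
  if c = 0 ∨ c = 2 then 0 else if c = 1 ∨ c = 3 ∨ c = 5 then 1 else 2

theorem carryPotential_step {c c' x y : ℕ} (hc : c ≤ 11) (hx : x < 3) (hy : y < 3)
    (h : 7 * x + 5 * y + c = 1 + 3 * c') :
    carryPotential c' + 1 ≤ carryPotential c + x + y := by
  have hc' : c' = (7 * x + 5 * y + c - 1) / 3 := by omega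
  unfold carryPotential
  interval_cases x <;> interval_cases y <;> split_ifs <;> omega

theorem carryPotential_add_le_sum_digits (m : ℕ) :
    ∀ {r s c c' : ℕ}, r < 3 ^ m → s < 3 ^ m → c ≤ 11 →
      14 * r + 10 * s + 2 * c + 1 = 3 ^ m * (2 * c' + 1) →
      carryPotential c' + m ≤
        carryPotential c + (Nat.digits 3 r).sum + (Nat.digits 3 s).sum := by
  induction m with
  | zero =>
    intro r s c c' hr hs _ h
    obtain rfl : r = 0 := by omega
    obtain rfl : s = 0 := by omega
    obtain rfl : c = c' := by omega
    simp
  | succ m ih =>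
    intro r s c c' hr hs hc h
    rw [pow_succ] at hr hs h
    have h3 : 3 ^ m * 3 * (2 * c' + 1) = 3 * (3 ^ m * (2 * c' + 1)) := by ring
    rw [h3] at h
    generalize hP : 3 ^ m * (2 * c' + 1) = P at h ih
    obtain ⟨d, hd⟩ : ∃ d, 7 * (r % 3) + 5 * (s % 3) + c = 1 + 3 * d :=
      ⟨(7 * (r % 3) + 5 * (s % 3) + c - 1) / 3, by omega⟩
    have hstep := carryPotential_step hc (Nat.mod_lt r (by norm_num))
      (Nat.mod_lt s (by norm_num)) hd
    have hrec := ih (r := r / 3) (s := s / 3) (c := d) (c' := c')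
      (by omega) (by omega) (by omega) (by omega)
    rw [sum_digits_three_eq r, sum_digits_three_eq s]
    omega

/-- For `q = 3^m` with `m` odd and `3 ∤ m`, and every `0 ≤ a ≤ q − 2`,
`w(5a mod (q−1)) + w(((q−1)/2 − 7a) mod (q−1)) ≥ m`, where `w` denotes the
ternary digit sum. -/
theorem weight_sum_ge_m_one_variable
    (m : ℕ) (hm : Odd m) (hm3 : ¬ (3 ∣ m)) (a : ℕ) (ha : a ≤ 3 ^ m - 2) :
    m ≤ (Nat.digits 3 (5 * a % (3 ^ m - 1))).sum +
      (Nat.digits 3 ((((3 ^ m - 1 : ℤ) / 2 - 7 * (a : ℤ)) % ((3 : ℤ) ^ m - 1)).toNat)).sum := by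
  have hm0 : m ≠ 0 := by rintro rfl; simp at hm
  have hodd : Odd (3 ^ m) := Odd.pow (by decide)
  have hq : 3 ≤ 3 ^ m := Nat.le_self_pow hm0 3
  obtain ⟨n, hn⟩ := hodd
  have hnz : (3 : ℤ) ^ m = 2 * n + 1 := by exact_mod_cast hn
  have hhalf : ((3 : ℤ) ^ m - 1) / 2 = n := by omega
  have hsub : (3 : ℤ) ^ m - 1 = 2 * n := by omega
  have hsub' : 3 ^ m - 1 = 2 * n := by omega
  rw [hhalf, hsub, hsub']
  have hn1 : 0 < n := by omega
  have hr := Nat.mod_lt (5 * a) (show 2 * n > 0 by omega)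
  have hr' := Nat.mod_add_div (5 * a) (2 * n)
  have hs0 := Int.emod_nonneg ((n : ℤ) - 7 * a) (show (2 * n : ℤ) ≠ 0 by omega)
  have hs := Int.emod_lt_of_pos ((n : ℤ) - 7 * a) (show (0 : ℤ) < 2 * n by omega)
  have hs' := Int.emod_add_mul_ediv ((n : ℤ) - 7 * a) (2 * n)
  generalize 5 * a % (2 * n) = r at hr hr' ⊢
  generalize 5 * a / (2 * n) = k at hr'
  generalize ((n : ℤ) - 7 * a) / (2 * n) = l at hs'
  lift ((n : ℤ) - 7 * a) % (2 * n) to ℕ using hs0 with s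
  rw [Int.toNat_natCast]
  zify at hr hr' hn1
  have key : (7 * r + 5 * s : ℤ) = n + 2 * n * (2 - 7 * k - 5 * l) := by
    linear_combination 7 * hr' + 5 * hs'
  generalize (2 - 7 * k - 5 * l : ℤ) = K at key
  have hK0 : 0 ≤ K := by by_contra!; nlinarith
  have hK : K ≤ 11 := by by_contra!; nlinarith
  lift K to ℕ using hK0
  have heq : 14 * r + 10 * s + 2 * K + 1 = 3 ^ m * (2 * K + 1) := by
    rw [hn]
    zify
    linear_combination 2 * key
  have := carryPotential_add_le_sum_digits m (by omega) (by omega) (by omega) heq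
  omega
end

section
/- Under the carry-sequence setup, if c_i = 5 and c_{i−1} = c_{i−2} = 4 for some index i, then c_{i−3} ≤ 4. -/
/-- No carry equals `6`. -/
theorem carry_le_five
    {a b c : ℤ → ℤ} (ha : ∀ i, 0 ≤ a i ∧ a i ≤ 2) (hb : ∀ i, 0 ≤ b i ∧ b i ≤ 2)
    (hc : ∀ i, 0 ≤ c i ∧ c i ≤ 6)
    (hs : ∀ i, 0 ≤ (9 - 2 * a (i - 1) + a i - b (i - 2) + b (i - 1) - b i) - 3 * c i + c (i - 1) ∧
      (9 - 2 * a (i - 1) + a i - b (i - 2) + b (i - 1) - b i) - 3 * c i + c (i - 1) ≤ 2)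
    (j : ℤ) : c j ≤ 5 := by
  have s0 := hs j
  have s1 := hs (j - 1)
  simp only [sub_sub, Int.reduceAdd] at s0 s1
  have a0 := ha j
  have a1 := ha (j - 1)
  have a2 := ha (j - 2)
  have b0 := hb j
  have b1 := hb (j - 1)
  have b2 := hb (j - 2)
  have b3 := hb (j - 3)
  have c2 := hc (j - 2)
  omega

/-- A carry equal to `5` forces `b j < a j` and `b j + 2 ≤ a j + b (j - 1)`. -/
theorem lt_and_add_two_le_of_carry_eq_five
    {a b c : ℤ → ℤ} (ha : ∀ i, 0 ≤ a i ∧ a i ≤ 2) (hb : ∀ i, 0 ≤ b i ∧ b i ≤ 2)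
    (hc : ∀ i, c i ≤ 5)
    (hs : ∀ i, 0 ≤ (9 - 2 * a (i - 1) + a i - b (i - 2) + b (i - 1) - b i) - 3 * c i + c (i - 1) ∧
      (9 - 2 * a (i - 1) + a i - b (i - 2) + b (i - 1) - b i) - 3 * c i + c (i - 1) ≤ 2)
    {j : ℤ} (hj : c j = 5) :
    b j < a j ∧ b j + 2 ≤ a j + b (j - 1) := by
  have s0 := hs j
  have s1 := hs (j - 1)
  have s2 := hs (j - 2)
  have s3 := hs (j - 3)
  simp only [sub_sub, Int.reduceAdd] at s0 s1 s2 s3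
  have a1 := ha (j - 1)
  have a2 := ha (j - 2)
  have a3 := ha (j - 3)
  have b1 := hb (j - 1)
  have b2 := hb (j - 2)
  have b3 := hb (j - 3)
  have b4 := hb (j - 4)
  have c3 := hc (j - 3)
  omega

/-- In the carry-sequence setup, if `c_i = 5` and `c_{i−1} = c_{i−2} = 4` then
`c_{i−3} ≤ 4`. -/
theorem carry_five_four_four_then_le_four
    (m : ℕ) (hm : 0 < m)
    (a b c : ℤ → ℤ)
    (ha : ∀ i, 0 ≤ a i ∧ a i ≤ 2) (hap : ∀ i, a (i + (m : ℤ)) = a i)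
    (hb : ∀ i, 0 ≤ b i ∧ b i ≤ 2) (hbp : ∀ i, b (i + (m : ℤ)) = b i)
    (hc : ∀ i, 0 ≤ c i ∧ c i ≤ 6) (hcp : ∀ i, c (i + (m : ℤ)) = c i)
    (hs : ∀ i, 0 ≤ (9 - 2 * a (i - 1) + a i - b (i - 2) + b (i - 1) - b i) - 3 * c i + c (i - 1) ∧
      (9 - 2 * a (i - 1) + a i - b (i - 2) + b (i - 1) - b i) - 3 * c i + c (i - 1) ≤ 2) :
    ∀ i, c i = 5 → c (i - 1) = 4 → c (i - 2) = 4 → c (i - 3) ≤ 4 := by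
  intro i h0 h1 h2
  have hc5 := carry_le_five ha hb hc hs
  by_contra! h3
  have c3 := hc5 (i - 3)
  obtain ⟨hlt, hle⟩ := lt_and_add_two_le_of_carry_eq_five ha hb hc5 hs (le_antisymm c3 h3)
  rw [sub_sub, show (3 : ℤ) + 1 = 4 from rfl] at hle
  have s0 := hs i
  have s1 := hs (i - 1)
  have s2 := hs (i - 2)
  simp only [sub_sub, Int.reduceAdd] at s0 s1 s2
  have a0 := ha i
  have b0 := hb i
  have b1 := hb (i - 1)
  have b2 := hb (i - 2)
  have b3 := hb (i - 3)
  omega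
end
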